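/- arXiv:2303.03191 — 2 statements merged into one kernel-verified Lean document; each statement's English description precedes it below -/
import Mathlib

section
/- Let B, u : (Fin 3 → ℝ) → (Fin 3 → ℝ) be smooth vector fields on ℝ³ and f : (Fin 3 → ℝ) → ℝ a smooth function with f x > 0 for all x. Assume div B = 0 everywhere. Then for every x ∈ ℝ³: f x • lie u (fun y => (f y)⁻¹ • B y) x = curl (fun y => (B y) ×₃ (u y)) x − ((div (fun y => f y • u y) x) / f x) • B x. -/
open Matrix
open scoped ContDiff

/-- Divergence of a vector field on `ℝ³`. -/
noncomputable def vdiv (X : (Fin 3 → ℝ) → (Fin 3 → ℝ)) (x : Fin 3 → ℝ) : ℝ :=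
  ∑ i : Fin 3, fderiv ℝ X x (Pi.single i 1) i

/-- Curl of a vector field on `ℝ³`. -/
noncomputable def vcurl (X : (Fin 3 → ℝ) → (Fin 3 → ℝ)) (x : Fin 3 → ℝ) : Fin 3 → ℝ :=
  ![fderiv ℝ X x (Pi.single 1 1) 2 - fderiv ℝ X x (Pi.single 2 1) 1,
    fderiv ℝ X x (Pi.single 2 1) 0 - fderiv ℝ X x (Pi.single 0 1) 2,
    fderiv ℝ X x (Pi.single 0 1) 1 - fderiv ℝ X x (Pi.single 1 1) 0]

/-- Lie bracket of vector fields on `ℝ³`. -/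
noncomputable def vlie (X Y : (Fin 3 → ℝ) → (Fin 3 → ℝ)) (x : Fin 3 → ℝ) : Fin 3 → ℝ :=
  fderiv ℝ Y x (X x) - fderiv ℝ X x (Y x)

/-- Leibniz rule for the cross product of two vector fields. -/
theorem fderiv_crossProduct_apply {X Y : (Fin 3 → ℝ) → (Fin 3 → ℝ)} {x : Fin 3 → ℝ}
    (hX : DifferentiableAt ℝ X x) (hY : DifferentiableAt ℝ Y x) (v : Fin 3 → ℝ) :
    fderiv ℝ (fun y => X y ⨯₃ Y y) x v =
      X x ⨯₃ fderiv ℝ Y x v + fderiv ℝ X x v ⨯₃ Y x :=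
  congrArg (· v) ((LinearMap.toContinuousBilinearMap crossProduct).fderiv_of_bilinear hX hY)

/-- A directional derivative on `ℝ³` in terms of partial derivatives. -/
theorem fderiv_apply_eq_sum_partial {F : Type*} [NormedAddCommGroup F] [NormedSpace ℝ F]
    (g : (Fin 3 → ℝ) → F) (x v : Fin 3 → ℝ) :
    fderiv ℝ g x v = ∑ i, v i • fderiv ℝ g x (Pi.single i 1) := by
  conv_lhs => rw [← Finset.univ_sum_single v, map_sum]
  refine Finset.sum_congr rfl fun i _ => ?_
  rw [← map_smul, ← Pi.single_smul, smul_eq_mul, mul_one]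

/-- Product rule for the divergence. -/
theorem vdiv_smul {f : (Fin 3 → ℝ) → ℝ} {X : (Fin 3 → ℝ) → (Fin 3 → ℝ)} {x : Fin 3 → ℝ}
    (hf : DifferentiableAt ℝ f x) (hX : DifferentiableAt ℝ X x) :
    vdiv (fun y => f y • X y) x = f x * vdiv X x + fderiv ℝ f x (X x) := by
  rw [fderiv_apply_eq_sum_partial f]
  simp only [vdiv, fderiv_fun_smul hf hX, Finset.mul_sum, ← Finset.sum_add_distrib]
  simp [mul_comm]

/-- Product rule for the Lie bracket in its second argument. -/
theorem vlie_smul_right {f : (Fin 3 → ℝ) → ℝ} {X Y : (Fin 3 → ℝ) → (Fin 3 → ℝ)}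
    {x : Fin 3 → ℝ} (hf : DifferentiableAt ℝ f x) (hY : DifferentiableAt ℝ Y x) :
    vlie X (fun y => f y • Y y) x = f x • vlie X Y x + fderiv ℝ f x (X x) • Y x := by
  simp only [vlie, fderiv_fun_smul hf hY]
  simp [smul_sub]
  abel

/-- The curl of a cross product. -/
theorem vcurl_crossProduct {X Y : (Fin 3 → ℝ) → (Fin 3 → ℝ)} {x : Fin 3 → ℝ}
    (hX : DifferentiableAt ℝ X x) (hY : DifferentiableAt ℝ Y x) :
    vcurl (fun y => X y ⨯₃ Y y) x = vdiv Y x • X x - vdiv X x • Y x + vlie Y X x := by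
  simp only [vcurl, vdiv, vlie, fderiv_crossProduct_apply hX hY,
    fderiv_apply_eq_sum_partial X x (Y x), fderiv_apply_eq_sum_partial Y x (X x)]
  ext i
  fin_cases i <;> simp [cross_apply, Fin.sum_univ_three] <;> ring

/-- For smooth `B, u` and smooth positive `f` on `ℝ³` with `div B = 0`,
`f x • [u, B/f] x = curl (B × u) x − (div (f u) x / f x) • B x` for every `x`. -/
theorem stmt_5 (B u : (Fin 3 → ℝ) → (Fin 3 → ℝ)) (f : (Fin 3 → ℝ) → ℝ)
    (hB : ContDiff ℝ ∞ B) (hu : ContDiff ℝ ∞ u) (hf : ContDiff ℝ ∞ f)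
    (hfpos : ∀ x, 0 < f x) (hdivB : ∀ x, vdiv B x = 0) :
    ∀ x : Fin 3 → ℝ,
      f x • vlie u (fun y => (f y)⁻¹ • B y) x =
        vcurl (fun y => (B y) ⨯₃ (u y)) x - ((vdiv (fun y => f y • u y) x) / f x) • B x := by
  intro x
  have hBx := hB.differentiable (by simp) x
  have hux := hu.differentiable (by simp) x
  have hfx := hf.differentiable (by simp) x
  have hne := (hfpos x).ne'
  have hinv : fderiv ℝ (fun y => (f y)⁻¹) x (u x) = -fderiv ℝ f x (u x) / f x ^ 2 := by
    have h := (hasDerivAt_inv hne).comp_hasFDerivAt x hfx.hasFDerivAt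
    rw [show (fun y => (f y)⁻¹) = (fun t : ℝ => t⁻¹) ∘ f from rfl, h.fderiv]
    simp
    ring
  rw [vlie_smul_right (hfx.fun_inv hne) hBx, vcurl_crossProduct hBx hux, vdiv_smul hfx hux,
    hdivB x, hinv]
  ext i
  simp
  field_simp
  ring
end

section
/- Let B : (Fin 3 → ℝ) → (Fin 3 → ℝ) be a smooth vector field with div B = 0 and B x ≠ 0 for all x, and let ψ : (Fin 3 → ℝ) → ℝ be smooth with ⟪B x, grad ψ x⟫ = 0 and ⟪curl B x, grad ψ x⟫ = 0 for all x. Define u := fun x => (⟪B x, B x⟫)⁻¹ • ((grad ψ x) ×₃ (B x)). Then for all x: (B x) ×₃ (u x) = grad ψ x, div (fun y => ⟪B y, B y⟫ • u y) = 0, and lie u (fun y => (⟪B y, B y⟫)⁻¹ • B y) x = 0; that is, u and B/‖B‖² are commuting vector fields. -/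
open Matrix
open scoped ContDiff

/-- Gradient of a function on `ℝ³`. -/
noncomputable def vgrad (p : (Fin 3 → ℝ) → ℝ) (x : Fin 3 → ℝ) : Fin 3 → ℝ :=
  fun i => fderiv ℝ p x (Pi.single i 1)

theorem HasFDerivAt.dotProduct_fin_three {f g : (Fin 3 → ℝ) → (Fin 3 → ℝ)}
    {f' g' : (Fin 3 → ℝ) →L[ℝ] (Fin 3 → ℝ)} {x : Fin 3 → ℝ}
    (hf : HasFDerivAt f f' x) (hg : HasFDerivAt g g' x) :
    ∃ L : (Fin 3 → ℝ) →L[ℝ] ℝ, HasFDerivAt (fun y => f y ⬝ᵥ g y) L x ∧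
      ∀ v, L v = f' v ⬝ᵥ g x + f x ⬝ᵥ g' v :=
  ⟨_, (dotProductBilin ℝ ℝ (m := Fin 3)
    (A := ℝ)).toContinuousBilinearMap.hasFDerivAt_of_bilinear hf hg, fun _ => add_comm _ _⟩

theorem HasFDerivAt.crossProduct_fin_three {f g : (Fin 3 → ℝ) → (Fin 3 → ℝ)}
    {f' g' : (Fin 3 → ℝ) →L[ℝ] (Fin 3 → ℝ)} {x : Fin 3 → ℝ}
    (hf : HasFDerivAt f f' x) (hg : HasFDerivAt g g' x) :
    ∃ L : (Fin 3 → ℝ) →L[ℝ] (Fin 3 → ℝ), HasFDerivAt (fun y => f y ⨯₃ g y) L x ∧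
      ∀ v, L v = f' v ⨯₃ g x + f x ⨯₃ g' v :=
  ⟨_, (crossProduct (R := ℝ)).toContinuousBilinearMap.hasFDerivAt_of_bilinear hf hg,
    fun _ => add_comm _ _⟩

/-- The derivative of `f / n` for a scalar field `n` and a vector field `f`. -/
theorem fderiv_inv_smul_apply {n : (Fin 3 → ℝ) → ℝ} {f : (Fin 3 → ℝ) → (Fin 3 → ℝ)}
    {n' : (Fin 3 → ℝ) →L[ℝ] ℝ} {f' : (Fin 3 → ℝ) →L[ℝ] (Fin 3 → ℝ)} {x : Fin 3 → ℝ}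
    (hn : HasFDerivAt n n' x) (hf : HasFDerivAt f f' x) (hx : n x ≠ 0) (v : Fin 3 → ℝ) :
    fderiv ℝ (fun y => (n y)⁻¹ • f y) x v = (n x)⁻¹ • f' v - (n' v / n x ^ 2) • f x := by
  have hinv : HasFDerivAt (fun y => (n y)⁻¹) (-(n x ^ 2)⁻¹ • n') x :=
    (hasDerivAt_inv hx).comp_hasFDerivAt x hn
  rw [show fderiv ℝ (fun y => (n y)⁻¹ • f y) x = _ from (hinv.smul hf).fderiv]
  ext i
  simp
  ring

theorem hasFDerivAt_vgrad {ψ : (Fin 3 → ℝ) → ℝ} (hψ : ContDiff ℝ 2 ψ) (x : Fin 3 → ℝ) :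
    ∃ H : (Fin 3 → ℝ) →L[ℝ] (Fin 3 → ℝ), HasFDerivAt (vgrad ψ) H x ∧
      ∀ v i, H v i = fderiv ℝ (fderiv ℝ ψ) x v (Pi.single i 1) := by
  have hd : DifferentiableAt ℝ (fderiv ℝ ψ) x :=
    (hψ.fderiv_right (m := 1) (by norm_num)).differentiable (by norm_num) x
  refine ⟨ContinuousLinearMap.pi fun i =>
    (fderiv ℝ (fderiv ℝ ψ) x).flip (Pi.single i 1), ?_, fun v i => rfl⟩
  rw [hasFDerivAt_pi]
  intro i
  exact (ContinuousLinearMap.apply ℝ ℝ (Pi.single i 1 : Fin 3 → ℝ)).hasFDerivAt.comp x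
    hd.hasFDerivAt

/-- The second derivative of `ψ` is symmetric. -/
theorem fderiv_vgrad_symm {ψ : (Fin 3 → ℝ) → ℝ} (hψ : ContDiff ℝ 2 ψ) (x : Fin 3 → ℝ)
    (i j : Fin 3) :
    fderiv ℝ (vgrad ψ) x (Pi.single i 1) j = fderiv ℝ (vgrad ψ) x (Pi.single j 1) i := by
  obtain ⟨H, hH, hHv⟩ := hasFDerivAt_vgrad hψ x
  rw [hH.fderiv, hHv, hHv]
  exact hψ.contDiffAt.isSymmSndFDerivAt (by simp) _ _

theorem ContinuousLinearMap.apply_fin_three (L : (Fin 3 → ℝ) →L[ℝ] (Fin 3 → ℝ))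
    (v : Fin 3 → ℝ) (j : Fin 3) :
    L v j = v 0 * L (Pi.single 0 1) j + v 1 * L (Pi.single 1 1) j
      + v 2 * L (Pi.single 2 1) j := by
  conv_lhs => rw [pi_eq_sum_univ' v]
  simp [Fin.sum_univ_three]

/-- Pointwise form of `div (g × b) = b · curl g - g · curl b`, with `D`, `H` the derivatives
of `b`, `g` and `g` curl-free. -/
theorem trace_crossProduct_eq_zero (D H : (Fin 3 → ℝ) →L[ℝ] (Fin 3 → ℝ)) (b g : Fin 3 → ℝ)
    (hH : ∀ i j, H (Pi.single i 1) j = H (Pi.single j 1) i)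
    (hcurl : ![D (Pi.single 1 1) 2 - D (Pi.single 2 1) 1,
      D (Pi.single 2 1) 0 - D (Pi.single 0 1) 2,
      D (Pi.single 0 1) 1 - D (Pi.single 1 1) 0] ⬝ᵥ g = 0) :
    ∑ i : Fin 3, (H (Pi.single i 1) ⨯₃ b + g ⨯₃ D (Pi.single i 1)) i = 0 := by
  have h01 := hH 0 1
  have h02 := hH 0 2
  have h12 := hH 1 2
  rw [vec3_dotProduct] at hcurl
  simp [Fin.sum_univ_three, cross_apply] at hcurl ⊢
  linear_combination b 2 * h01 - b 1 * h02 + b 0 * h12 - hcurl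

/-- Pointwise form of `[g × b / b², b / b²] = 0`, with denominators cleared; `D`, `H` are the
derivatives of `b`, `g`. -/
theorem bracket_crossProduct_eq_zero (D H : (Fin 3 → ℝ) →L[ℝ] (Fin 3 → ℝ)) (b g : Fin 3 → ℝ)
    (hH : ∀ i j, H (Pi.single i 1) j = H (Pi.single j 1) i)
    (htr : ∑ i : Fin 3, D (Pi.single i 1) i = 0) (hbg : b ⬝ᵥ g = 0)
    (hDH : ∀ v, D v ⬝ᵥ g + b ⬝ᵥ H v = 0)
    (hcurl : ![D (Pi.single 1 1) 2 - D (Pi.single 2 1) 1,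
      D (Pi.single 2 1) 0 - D (Pi.single 0 1) 2,
      D (Pi.single 0 1) 1 - D (Pi.single 1 1) 0] ⬝ᵥ g = 0) :
    (b ⬝ᵥ b) • D (g ⨯₃ b) - (2 * (b ⬝ᵥ D (g ⨯₃ b))) • b
      - (b ⬝ᵥ b) • (H b ⨯₃ b + g ⨯₃ D b) + (2 * (b ⬝ᵥ D b)) • (g ⨯₃ b) = 0 := by
  have hHb (i : Fin 3) : H b i = -(D (Pi.single i 1) ⬝ᵥ g) := by
    rw [H.apply_fin_three, hH 0, hH 1, hH 2]
    have := hDH (Pi.single i 1)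
    rw [vec3_dotProduct b] at this
    linear_combination this
  simp only [vec3_dotProduct, Fin.sum_univ_three] at hHb htr hbg hcurl
  simp only [cons_val_zero, cons_val_one, cons_val] at hcurl
  have hc0 : (g ⨯₃ b) 0 = g 1 * b 2 - g 2 * b 1 := by simp [cross_apply]
  have hc1 : (g ⨯₃ b) 1 = g 2 * b 0 - g 0 * b 2 := by simp [cross_apply]
  have hc2 : (g ⨯₃ b) 2 = g 0 * b 1 - g 1 * b 0 := by simp [cross_apply]
  generalize g ⨯₃ b = c at *
  ext i
  simp only [Pi.add_apply, Pi.sub_apply, Pi.smul_apply, Pi.zero_apply, smul_eq_mul,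
    vec3_dotProduct, D.apply_fin_three c, D.apply_fin_three b, cross_apply, hHb]
  generalize D (Pi.single 0 1) = d0 at *
  generalize D (Pi.single 1 1) = d1 at *
  generalize D (Pi.single 2 1) = d2 at *
  clear hHb hH hDH
  fin_cases i <;> simp <;> simp only [hc0, hc1, hc2] <;> grind

/-- Boozer coordinates observation: for a non-vanishing divergence-free `B`
with `B·∇ψ = 0` and `(curl B)·∇ψ = 0`, the field `u = ∇ψ × B / B²` satisfies
`B × u = ∇ψ`, `div (B² u) = 0` and `[u, B/B²] = 0`. -/
theorem stmt_9 (B : (Fin 3 → ℝ) → (Fin 3 → ℝ)) (ψ : (Fin 3 → ℝ) → ℝ)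
    (hB : ContDiff ℝ ∞ B) (hψ : ContDiff ℝ ∞ ψ)
    (hdivB : ∀ x, vdiv B x = 0) (hBne : ∀ x, B x ≠ 0)
    (hBψ : ∀ x, B x ⬝ᵥ vgrad ψ x = 0)
    (hJψ : ∀ x, vcurl B x ⬝ᵥ vgrad ψ x = 0) :
    ∀ x : Fin 3 → ℝ,
      (B x) ⨯₃ ((B x ⬝ᵥ B x)⁻¹ • ((vgrad ψ x) ⨯₃ (B x))) = vgrad ψ x ∧
      vdiv (fun y => (B y ⬝ᵥ B y) • ((B y ⬝ᵥ B y)⁻¹ • ((vgrad ψ y) ⨯₃ (B y)))) x = 0 ∧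
      vlie (fun y => (B y ⬝ᵥ B y)⁻¹ • ((vgrad ψ y) ⨯₃ (B y)))
        (fun y => (B y ⬝ᵥ B y)⁻¹ • B y) x = 0 := by
  intro x
  have hψ2 : ContDiff ℝ 2 ψ := contDiff_infty.1 hψ 2
  have hBD : HasFDerivAt B (fderiv ℝ B x) x := (hB.differentiable (by simp) x).hasFDerivAt
  have hgH : HasFDerivAt (vgrad ψ) (fderiv ℝ (vgrad ψ) x) x := by
    obtain ⟨H, hH, -⟩ := hasFDerivAt_vgrad hψ2 x
    exact hH.differentiableAt.hasFDerivAt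
  have hsymm := fderiv_vgrad_symm hψ2 x
  have hn (y) : B y ⬝ᵥ B y ≠ 0 := fun h => hBne y (dotProduct_self_eq_zero.1 h)
  obtain ⟨n', hn', hn'v⟩ := hBD.dotProduct_fin_three hBD
  obtain ⟨c', hc', hc'v⟩ := hgH.crossProduct_fin_three hBD
  have hDH (v) : fderiv ℝ B x v ⬝ᵥ vgrad ψ x + B x ⬝ᵥ fderiv ℝ (vgrad ψ) x v = 0 := by
    obtain ⟨L, hL, hLv⟩ := hBD.dotProduct_fin_three hgH
    simp only [hBψ] at hL
    rw [← hLv, hL.unique (hasFDerivAt_const 0 x), _root_.zero_apply]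
  refine ⟨?_, ?_, ?_⟩
  · rw [map_smul, inv_smul_eq_iff₀ (hn x)]
    have h := hBψ x
    ext i
    rw [vec3_dotProduct] at h
    fin_cases i <;> simp [cross_apply, vec3_dotProduct] <;> grind
  · simp only [smul_inv_smul₀ (hn _), vdiv, hc'.fderiv, hc'v]
    exact trace_crossProduct_eq_zero _ _ _ _ hsymm (hJψ x)
  · have key := bracket_crossProduct_eq_zero _ _ _ _ hsymm (hdivB x) (hBψ x) hDH (hJψ x)
    rw [vlie, fderiv_inv_smul_apply hn' hBD (hn x), fderiv_inv_smul_apply hn' hc' (hn x)]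
    simp only [map_smul, hn'v, hc'v]
    have hx := hn x
    ext i
    have := congrFun key i
    simp [dotProduct_comm _ (B x)] at this ⊢
    field_simp
    linear_combination this
end
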